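/- arXiv:2307.12581 — 4 statements merged into one kernel-verified Lean document; each statement's English description precedes it below -/
import Mathlib

section
/- For every n ≥ 1 and every fixed symmetric matrix J ∈ ℝ^{n×n}, one has ∫_{O(n)} p(Qᵀ J Q) dμ(Q) ≤ p^S(J), where μ is the Haar probability measure on the orthogonal group O(n). -/
open MeasureTheory Matrix Real Filter

/-- The quadratic form `xᵀ J x`. -/
noncomputable def qf {n : ℕ} (J : Matrix (Fin n) (Fin n) ℝ) (x : Fin n → ℝ) : ℝ :=
  ∑ i, ∑ j, x i * J i j * x j

/-- The `±1` vector associated to a boolean vector; these enumerate `{-1,1}ⁿ`. -/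
noncomputable def sgn {n : ℕ} (b : Fin n → Bool) : Fin n → ℝ :=
  fun i => if b i then 1 else -1

/-- Normalized Ising partition function `Ẑ(J) = 2⁻ⁿ ∑_{x ∈ {-1,1}ⁿ} exp(½ xᵀJx)`. -/
noncomputable def isingZ {n : ℕ} (J : Matrix (Fin n) (Fin n) ℝ) : ℝ :=
  ((2 : ℝ) ^ n)⁻¹ * ∑ b : Fin n → Bool, Real.exp ((1 / 2) * qf J (sgn b))

/-- Ising pressure `p(J) = n⁻¹ log Ẑ(J)`. -/
noncomputable def isingP {n : ℕ} (J : Matrix (Fin n) (Fin n) ℝ) : ℝ :=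
  (n : ℝ)⁻¹ * Real.log (isingZ J)

/-- The uniform (rotation-invariant) probability measure on the sphere of radius `√n`
in Euclidean `ℝⁿ`: the rotation-invariant surface measure on the unit sphere,
normalized to a probability measure and pushed forward by scaling by `√n`. -/
noncomputable def unifSphere (n : ℕ) : Measure (EuclideanSpace ℝ (Fin n)) :=
  Measure.map (fun x : Metric.sphere (0 : EuclideanSpace ℝ (Fin n)) 1 =>
      (Real.sqrt n) • (x : EuclideanSpace ℝ (Fin n)))
    (((volume : Measure (EuclideanSpace ℝ (Fin n))).toSphere Set.univ)⁻¹ •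
      (volume : Measure (EuclideanSpace ℝ (Fin n))).toSphere)

/-- Spherical normalized partition function `Ẑ^S(J) = E_{x ~ Unif(S^{n-1}(√n))} exp(½ xᵀJx)`. -/
noncomputable def sphZ {n : ℕ} (J : Matrix (Fin n) (Fin n) ℝ) : ℝ :=
  ∫ x, Real.exp ((1 / 2) * qf J (fun i => x i)) ∂(unifSphere n)

/-- Spherical pressure `p^S(J) = n⁻¹ log Ẑ^S(J)`. -/
noncomputable def sphP {n : ℕ} (J : Matrix (Fin n) (Fin n) ℝ) : ℝ :=
  (n : ℝ)⁻¹ * Real.log (sphZ J)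

noncomputable instance {n : ℕ} : MeasurableSpace (Matrix (Fin n) (Fin n) ℝ) :=
  inferInstanceAs (MeasurableSpace (Fin n → Fin n → ℝ))

theorem exists_orthogonal_mulVec_eq {n : ℕ} {x y : Fin n → ℝ} (h : x ⬝ᵥ x = y ⬝ᵥ y) :
    ∃ R : Matrix (Fin n) (Fin n) ℝ, Rᵀ * R = 1 ∧ R *ᵥ x = y := by
  by_cases hxy : x = y
  · exact ⟨1, by simp, by simp [hxy]⟩
  have hv : (x - y) ⬝ᵥ (x - y) ≠ 0 := by
    rwa [Ne, dotProduct_self_eq_zero, sub_eq_zero]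
  have hvx : (x - y) ⬝ᵥ (x - y) = 2 * ((x - y) ⬝ᵥ x) := by
    simp only [sub_dotProduct, dotProduct_sub, dotProduct_comm y x, ← h]
    ring
  refine ⟨1 - (2 / ((x - y) ⬝ᵥ (x - y))) • vecMulVec (x - y) (x - y), ?_, ?_⟩
  · simp only [transpose_sub, transpose_one, transpose_smul, transpose_vecMulVec,
      Matrix.sub_mul, Matrix.mul_sub, Matrix.one_mul, Matrix.mul_one, Matrix.smul_mul,
      Matrix.mul_smul, vecMulVec_mul_vecMulVec, vecMulVec_smul, smul_smul]
    rw [← sub_eq_zero]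
    ext i j
    simp only [Matrix.sub_apply, Matrix.smul_apply, smul_eq_mul, Matrix.zero_apply]
    field_simp
    ring
  · rw [Matrix.sub_mulVec, Matrix.one_mulVec, Matrix.smul_mulVec, vecMulVec_mulVec]
    ext i
    simp only [Pi.sub_apply, Pi.smul_apply, smul_eq_mul, MulOpposite.smul_eq_mul_unop,
      MulOpposite.unop_op] at hvx ⊢
    rw [hvx] at hv ⊢
    have hd := right_ne_zero_of_mul hv
    field_simp
    ring

theorem dotProduct_mulVec_self_of_orthogonal {n : ℕ} {R : Matrix (Fin n) (Fin n) ℝ}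
    (hR : Rᵀ * R = 1) (x : Fin n → ℝ) : (R *ᵥ x) ⬝ᵥ (R *ᵥ x) = x ⬝ᵥ x := by
  rw [dotProduct_mulVec, vecMul_mulVec, ← dotProduct_mulVec, hR, one_mulVec]

theorem qf_eq_dotProduct {n : ℕ} (J : Matrix (Fin n) (Fin n) ℝ) (x : Fin n → ℝ) :
    qf J x = x ⬝ᵥ J *ᵥ x := by
  simp [qf, dotProduct, mulVec, Finset.mul_sum, mul_assoc]

theorem qf_conj {n : ℕ} (J Q : Matrix (Fin n) (Fin n) ℝ) (x : Fin n → ℝ) :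
    qf (Qᵀ * J * Q) x = qf J (Q *ᵥ x) := by
  simp only [qf_eq_dotProduct, ← mulVec_mulVec, dotProduct_mulVec, vecMul_transpose]

theorem abs_qf_le {n : ℕ} (J : Matrix (Fin n) (Fin n) ℝ) (x : Fin n → ℝ) :
    |qf J x| ≤ (∑ i, ∑ j, |J i j|) * (x ⬝ᵥ x) := by
  simp only [qf, Finset.sum_mul]
  refine (Finset.abs_sum_le_sum_abs _ _).trans (Finset.sum_le_sum fun i _ ↦ ?_)
  refine (Finset.abs_sum_le_sum_abs _ _).trans (Finset.sum_le_sum fun j _ ↦ ?_)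
  have hle (k : Fin n) : |x k| ^ 2 ≤ x ⬝ᵥ x := by
    rw [sq_abs, sq]
    exact Finset.single_le_sum (f := fun k ↦ x k * x k) (fun k _ ↦ mul_self_nonneg _)
      (Finset.mem_univ k)
  have hij : |x i| * |x j| ≤ x ⬝ᵥ x := by
    nlinarith [hle i, hle j, sq_nonneg (|x i| - |x j|)]
  calc |x i * J i j * x j| = |J i j| * (|x i| * |x j|) := by rw [abs_mul, abs_mul]; ring
    _ ≤ _ := mul_le_mul_of_nonneg_left hij (abs_nonneg _)

theorem sgn_dotProduct_self {n : ℕ} (b : Fin n → Bool) : sgn b ⬝ᵥ sgn b = n := by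
  have (i : Fin n) : sgn b i * sgn b i = 1 := by
    unfold sgn; split_ifs <;> norm_num
  simp [dotProduct, this]

theorem measurable_matrix_entry {n : ℕ} (i j : Fin n) :
    Measurable fun Q : Matrix (Fin n) (Fin n) ℝ ↦ Q i j :=
  (measurable_pi_apply j).comp (measurable_pi_apply (X := fun _ : Fin n ↦ Fin n → ℝ) i)

theorem measurable_matrix {n : ℕ} {α : Type*} [MeasurableSpace α]
    {f : α → Matrix (Fin n) (Fin n) ℝ} (h : ∀ i j, Measurable fun a ↦ f a i j) : Measurable f :=
  measurable_pi_iff.2 fun i ↦ measurable_pi_iff.2 (h i)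

theorem measurable_matrix_mul_left {n : ℕ} (R : Matrix (Fin n) (Fin n) ℝ) :
    Measurable fun Q ↦ R * Q := by
  refine measurable_matrix fun i j ↦ ?_
  simp only [Matrix.mul_apply]
  exact Finset.measurable_sum _ fun k _ ↦ (measurable_matrix_entry k j).const_mul _

theorem measurable_mulVec_prod {n : ℕ} :
    Measurable fun p : Matrix (Fin n) (Fin n) ℝ × (Fin n → ℝ) ↦ p.1 *ᵥ p.2 := by
  refine measurable_pi_iff.2 fun i ↦ ?_
  have hentry (j : Fin n) :
      Measurable fun p : Matrix (Fin n) (Fin n) ℝ × (Fin n → ℝ) ↦ p.1 i j :=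
    (measurable_matrix_entry i j).comp measurable_fst
  have hcoord (j : Fin n) :
      Measurable fun p : Matrix (Fin n) (Fin n) ℝ × (Fin n → ℝ) ↦ p.2 j :=
    (measurable_pi_apply j).comp measurable_snd
  simp only [mulVec, dotProduct]
  fun_prop

theorem measurable_mulVec {n : ℕ} (R : Matrix (Fin n) (Fin n) ℝ) :
    Measurable fun x ↦ R *ᵥ x :=
  measurable_mulVec_prod.comp measurable_prodMk_left

theorem measurable_mulVec_left {n : ℕ} (x : Fin n → ℝ) :
    Measurable fun R : Matrix (Fin n) (Fin n) ℝ ↦ R *ᵥ x :=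
  measurable_mulVec_prod.comp measurable_prodMk_right

theorem measurable_matrix_transpose {n : ℕ} :
    Measurable fun Q : Matrix (Fin n) (Fin n) ℝ ↦ Qᵀ :=
  measurable_matrix fun i j ↦ measurable_matrix_entry j i

theorem measurable_qf {n : ℕ} (J : Matrix (Fin n) (Fin n) ℝ) : Measurable (qf J) := by
  unfold qf
  fun_prop

theorem measurableSet_orthogonal {n : ℕ} :
    MeasurableSet {Q : Matrix (Fin n) (Fin n) ℝ | Qᵀ * Q = 1} := by
  have : {Q : Matrix (Fin n) (Fin n) ℝ | Qᵀ * Q = 1} =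
      ⋂ i, ⋂ j, {Q | (Qᵀ * Q) i j = (1 : Matrix (Fin n) (Fin n) ℝ) i j} := by
    ext Q
    simp [← Matrix.ext_iff]
  rw [this]
  refine .iInter fun i ↦ .iInter fun j ↦ measurableSet_eq_fun ?_ measurable_const
  simp only [Matrix.mul_apply, transpose_apply]
  exact Finset.measurable_sum _ fun k _ ↦
    (measurable_matrix_entry k i).mul (measurable_matrix_entry k j)

/-- All rotation-invariant probability measures on a sphere integrate functions in the same way,
namely by averaging over the orbit of an arbitrary point of the sphere. -/
theorem lintegral_eq_lintegral_transpose_mulVec {n : ℕ} {μ : Measure (Matrix (Fin n) (Fin n) ℝ)}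
    [IsProbabilityMeasure μ] (hsupp : ∀ᵐ Q ∂μ, Qᵀ * Q = 1)
    (hinv : ∀ Q₀ : Matrix (Fin n) (Fin n) ℝ, Q₀ᵀ * Q₀ = 1 →
      Measure.map (fun Q => Q₀ * Q) μ = μ)
    {σ : Measure (Fin n → ℝ)} [IsProbabilityMeasure σ] {r : ℝ} (hσ : ∀ᵐ y ∂σ, y ⬝ᵥ y = r)
    (hσinv : ∀ R : Matrix (Fin n) (Fin n) ℝ, Rᵀ * R = 1 → σ.map (fun y ↦ R *ᵥ y) = σ)
    {f : (Fin n → ℝ) → ENNReal} (hf : Measurable f) {x : Fin n → ℝ} (hx : x ⬝ᵥ x = r) :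
    ∫⁻ y, f y ∂σ = ∫⁻ Q, f (Qᵀ *ᵥ x) ∂μ := by
  have horbit {y : Fin n → ℝ} (hy : y ⬝ᵥ y = r) :
      ∫⁻ Q, f (Qᵀ *ᵥ y) ∂μ = ∫⁻ Q, f (Qᵀ *ᵥ x) ∂μ := by
    obtain ⟨R, hR, rfl⟩ := exists_orthogonal_mulVec_eq (hx.trans hy.symm)
    conv_rhs => rw [← hinv Rᵀ (by rw [transpose_transpose]; exact mul_eq_one_comm.1 hR)]
    have hfx : Measurable fun Q : Matrix (Fin n) (Fin n) ℝ ↦ f (Qᵀ *ᵥ x) :=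
      hf.comp ((measurable_mulVec_left x).comp measurable_matrix_transpose)
    rw [lintegral_map hfx (measurable_matrix_mul_left _)]
    simp [transpose_mul]
  calc ∫⁻ y, f y ∂σ = ∫⁻ _ : Matrix (Fin n) (Fin n) ℝ, ∫⁻ y, f y ∂σ ∂μ := by simp
    _ = ∫⁻ Q, ∫⁻ y, f (Qᵀ *ᵥ y) ∂σ ∂μ := by
      refine lintegral_congr_ae (hsupp.mono fun Q hQ ↦ ?_)
      dsimp only
      rw [← lintegral_map hf (measurable_mulVec Qᵀ),
        hσinv _ (by rw [transpose_transpose]; exact mul_eq_one_comm.1 hQ)]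
    _ = ∫⁻ y, ∫⁻ Q, f (Qᵀ *ᵥ y) ∂μ ∂σ := by
      refine lintegral_lintegral_swap (Measurable.aemeasurable ?_)
      exact hf.comp (measurable_mulVec_prod.comp
        ((measurable_matrix_transpose.comp measurable_fst).prodMk measurable_snd))
    _ = ∫⁻ y, ∫⁻ Q, f (Qᵀ *ᵥ x) ∂μ ∂σ := lintegral_congr_ae (hσ.mono fun y hy ↦ horbit hy)
    _ = ∫⁻ Q, f (Qᵀ *ᵥ x) ∂μ := by simp

theorem measurable_sqrt_smul_sphere (n : ℕ) :
    Measurable fun x : Metric.sphere (0 : EuclideanSpace ℝ (Fin n)) 1 =>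
      (Real.sqrt n) • (x : EuclideanSpace ℝ (Fin n)) := by
  fun_prop

theorem isProbabilityMeasure_unifSphere {n : ℕ} (hn : 1 ≤ n) :
    IsProbabilityMeasure (unifSphere n) := by
  have : Nonempty (Fin n) := ⟨⟨0, hn⟩⟩
  have : IsProbabilityMeasure (((volume : Measure (EuclideanSpace ℝ (Fin n))).toSphere Set.univ)⁻¹ •
      (volume : Measure (EuclideanSpace ℝ (Fin n))).toSphere) := by
    refine ⟨?_⟩
    rw [Measure.smul_apply, smul_eq_mul]
    exact ENNReal.inv_mul_cancel
      (Measure.measure_univ_ne_zero.2 (Measure.toSphere_ne_zero _)) (measure_ne_top _ _)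
  exact Measure.isProbabilityMeasure_map (measurable_sqrt_smul_sphere n).aemeasurable

open scoped Pointwise in
theorem map_linearIsometryEquiv_unifSphere {n : ℕ}
    (e : EuclideanSpace ℝ (Fin n) ≃ₗᵢ[ℝ] EuclideanSpace ℝ (Fin n)) :
    (unifSphere n).map e = unifSphere n := by
  have hm := measurable_sqrt_smul_sphere n
  have he : Measurable e := e.continuous.measurable
  ext s hs
  set A : Set (Metric.sphere (0 : EuclideanSpace ℝ (Fin n)) 1) := (fun x ↦ (√n : ℝ) • x.1) ⁻¹' s
  have hcone : Set.Ioo (0 : ℝ) 1 • (Subtype.val '' ((fun x :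
      Metric.sphere (0 : EuclideanSpace ℝ (Fin n)) 1 ↦ (√n : ℝ) • x.1) ⁻¹' (e ⁻¹' s))) =
      e ⁻¹' (Set.Ioo (0 : ℝ) 1 • (Subtype.val '' A)) := by
    ext z
    simp only [A, Set.mem_smul, Set.mem_image, Set.mem_preimage, Subtype.exists,
      mem_sphere_iff_norm, sub_zero]
    constructor
    · rintro ⟨r, hr, _, ⟨u, hu, hus, rfl⟩, rfl⟩
      exact ⟨r, hr, _, ⟨e u, by simpa using hu, by simpa using hus, rfl⟩, by simp⟩
    · rintro ⟨r, hr, _, ⟨u, hu, hus, rfl⟩, hz⟩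
      refine ⟨r, hr, _, ⟨e.symm u, by simpa using hu, by simpa using hus, rfl⟩, ?_⟩
      apply e.injective
      simpa using hz
  rw [Measure.map_apply he hs, unifSphere, Measure.map_apply hm (he hs), Measure.map_apply hm hs,
    Measure.smul_apply, Measure.smul_apply, Measure.toSphere_apply' _ (hm (he hs)),
    Measure.toSphere_apply' _ (hm hs), hcone,
    e.measurePreserving.measure_preimage_emb e.toHomeomorph.measurableEmbedding]

theorem map_mulVec_map_ofLp_unifSphere {n : ℕ} {R : Matrix (Fin n) (Fin n) ℝ} (hR : Rᵀ * R = 1) :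
    ((unifSphere n).map WithLp.ofLp).map (fun y ↦ R *ᵥ y) = (unifSphere n).map WithLp.ofLp := by
  let e : EuclideanSpace ℝ (Fin n) ≃ₗᵢ[ℝ] EuclideanSpace ℝ (Fin n) :=
    LinearIsometry.toLinearIsometryEquiv
      ⟨toLpLin 2 2 R, fun x ↦ by
        rw [← sq_eq_sq₀ (norm_nonneg _) (norm_nonneg _), EuclideanSpace.real_norm_sq_eq,
          EuclideanSpace.real_norm_sq_eq]
        simpa [dotProduct, sq] using dotProduct_mulVec_self_of_orthogonal hR x.ofLp⟩ rfl
  have hofLp : Measurable (WithLp.ofLp : EuclideanSpace ℝ (Fin n) → Fin n → ℝ) :=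
    WithLp.measurable_ofLp 2 _
  rw [Measure.map_map (measurable_mulVec R) hofLp]
  conv_rhs => rw [← map_linearIsometryEquiv_unifSphere e,
    Measure.map_map hofLp e.continuous.measurable]
  rfl

theorem ae_dotProduct_self_map_ofLp_unifSphere (n : ℕ) :
    ∀ᵐ y : Fin n → ℝ ∂(unifSphere n).map WithLp.ofLp, y ⬝ᵥ y = (n : ℝ) := by
  have hofLp : Measurable (WithLp.ofLp : EuclideanSpace ℝ (Fin n) → Fin n → ℝ) :=
    WithLp.measurable_ofLp 2 _
  have hset : MeasurableSet {y : Fin n → ℝ | y ⬝ᵥ y = n} :=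
    measurableSet_eq_fun (by unfold dotProduct; fun_prop) measurable_const
  rw [ae_map_iff hofLp.aemeasurable hset, unifSphere]
  refine (ae_map_iff (measurable_sqrt_smul_sphere n).aemeasurable (hofLp hset)).2 ?_
  refine .of_forall fun x ↦ ?_
  have hx : ‖(√n : ℝ) • (x : EuclideanSpace ℝ (Fin n))‖ ^ 2 = n := by
    rw [norm_smul, norm_eq_of_mem_sphere x]
    simp
  rw [EuclideanSpace.real_norm_sq_eq] at hx
  simpa [dotProduct, sq] using hx

/-- The law of `Q x` for a random orthogonal `Q` and a fixed `x` with `‖x‖² = n` is the uniform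
measure on the sphere of radius `√n`. -/
theorem lintegral_mulVec_eq_lintegral_unifSphere {n : ℕ} (hn : 1 ≤ n)
    {μ : Measure (Matrix (Fin n) (Fin n) ℝ)}
    [IsProbabilityMeasure μ] (hsupp : ∀ᵐ Q ∂μ, Qᵀ * Q = 1)
    (hinv : ∀ Q₀ : Matrix (Fin n) (Fin n) ℝ, Q₀ᵀ * Q₀ = 1 →
      Measure.map (fun Q => Q₀ * Q) μ = μ)
    {f : (Fin n → ℝ) → ENNReal} (hf : Measurable f) {x : Fin n → ℝ} (hx : x ⬝ᵥ x = n) :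
    ∫⁻ Q, f (Q *ᵥ x) ∂μ = ∫⁻ y, f y.ofLp ∂unifSphere n := by
  have hofLp : Measurable (WithLp.ofLp : EuclideanSpace ℝ (Fin n) → Fin n → ℝ) :=
    WithLp.measurable_ofLp 2 _
  have hQx := measurable_mulVec_left x
  have := isProbabilityMeasure_unifSphere hn
  have : IsProbabilityMeasure ((unifSphere n).map WithLp.ofLp) :=
    Measure.isProbabilityMeasure_map hofLp.aemeasurable
  have : IsProbabilityMeasure (μ.map fun Q ↦ Q *ᵥ x) :=
    Measure.isProbabilityMeasure_map hQx.aemeasurable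
  have hset : MeasurableSet {y : Fin n → ℝ | y ⬝ᵥ y = n} :=
    measurableSet_eq_fun (by unfold dotProduct; fun_prop) measurable_const
  rw [← lintegral_map hf hQx, ← lintegral_map hf hofLp,
    lintegral_eq_lintegral_transpose_mulVec hsupp hinv
      (ae_dotProduct_self_map_ofLp_unifSphere n) (fun _ ↦ map_mulVec_map_ofLp_unifSphere) hf hx]
  refine lintegral_eq_lintegral_transpose_mulVec hsupp hinv ?_ (fun R hR ↦ ?_) hf hx
  · rw [ae_map_iff hQx.aemeasurable hset]
    exact hsupp.mono fun Q hQ ↦ (dotProduct_mulVec_self_of_orthogonal hQ x).trans hx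
  · conv_rhs => rw [← hinv R hR]
    rw [Measure.map_map (measurable_mulVec R) hQx,
      Measure.map_map hQx (measurable_matrix_mul_left R)]
    congr 1
    ext Q : 1
    simp

theorem exp_half_qf_mem_Icc {n : ℕ} (J : Matrix (Fin n) (Fin n) ℝ) {x : Fin n → ℝ}
    (hx : x ⬝ᵥ x = n) :
    Real.exp ((1 / 2) * qf J x) ∈
      Set.Icc (Real.exp (-((∑ i, ∑ j, |J i j|) * n))) (Real.exp ((∑ i, ∑ j, |J i j|) * n)) := by
  have h := abs_qf_le J x
  have h0 := abs_nonneg (qf J x)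
  rw [hx] at h
  constructor <;> apply Real.exp_le_exp.2 <;> nlinarith [abs_le.1 h]

theorem isingZ_mem_Icc {n : ℕ} {J : Matrix (Fin n) (Fin n) ℝ} {a b : ℝ}
    (h : ∀ c, Real.exp ((1 / 2) * qf J (sgn c)) ∈ Set.Icc a b) : isingZ J ∈ Set.Icc a b := by
  have h2 : (0 : ℝ) < 2 ^ n := by positivity
  have hcard : (Finset.univ : Finset (Fin n → Bool)).card = 2 ^ n := by simp
  unfold isingZ
  rw [inv_mul_eq_div, Set.mem_Icc, le_div_iff₀ h2, div_le_iff₀ h2]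
  constructor
  · have := Finset.card_nsmul_le_sum Finset.univ _ a fun c _ ↦ (h c).1
    rw [hcard, nsmul_eq_mul] at this
    push_cast at this
    linarith
  · have := Finset.sum_le_card_nsmul Finset.univ _ b fun c _ ↦ (h c).2
    rw [hcard, nsmul_eq_mul] at this
    push_cast at this
    linarith

/-- Jensen's inequality for the logarithm of a random variable with values in `[a, b]`, `0 < a`. -/
theorem integral_log_le_log_integral {Ω : Type*} [MeasurableSpace Ω] {μ : Measure Ω}
    [IsProbabilityMeasure μ] {Z : Ω → ℝ} (hZ : Measurable Z) {a b : ℝ} (ha : 0 < a)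
    (h : ∀ᵐ ω ∂μ, Z ω ∈ Set.Icc a b) :
    ∫ ω, Real.log (Z ω) ∂μ ≤ Real.log (∫ ω, Z ω ∂μ) := by
  have hint : Integrable Z μ := .of_mem_Icc a b hZ.aemeasurable h
  have hlog : Integrable (fun ω ↦ Real.log (Z ω)) μ :=
    .of_mem_Icc (Real.log a) (Real.log b) hZ.log.aemeasurable (h.mono fun ω hω ↦
      ⟨Real.log_le_log ha hω.1, Real.log_le_log (ha.trans_le hω.1) hω.2⟩)
  have hpos : 0 < ∫ ω, Z ω ∂μ := by
    have := integral_mono_ae (integrable_const a) hint (h.mono fun ω hω ↦ hω.1)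
    simp only [integral_const, probReal_univ, one_smul] at this
    exact ha.trans_le this
  set c := ∫ ω, Z ω ∂μ with hc
  have hle : ∀ᵐ ω ∂μ, Real.log (Z ω) ≤ Real.log c + (Z ω / c - 1) := by
    filter_upwards [h] with ω hω
    have hω0 := ha.trans_le hω.1
    have := Real.log_le_sub_one_of_pos (div_pos hω0 hpos)
    rw [Real.log_div hω0.ne' hpos.ne'] at this
    linarith
  refine (integral_mono_ae hlog ?_ hle).trans_eq ?_
  · exact (integrable_const _).add ((hint.div_const c).sub (integrable_const _))
  · have hsub : ∫ ω, (Z ω / c - 1) ∂μ = 0 := by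
      rw [integral_sub (hint.div_const c) (integrable_const _), integral_div, ← hc]
      simp [div_self hpos.ne']
    rw [integral_add (integrable_const _) (by fun_prop), hsub]
    simp

/-- For every fixed symmetric `J`, the average of `p(Qᵀ J Q)` over the Haar probability
measure `μ` on the orthogonal group `O(n)` (characterized as a probability measure on
matrices that is concentrated on `O(n)` and invariant under left translation by any
orthogonal matrix) is at most `p^S(J)`. -/
theorem stmt_1 {n : ℕ} (hn : 1 ≤ n) (J : Matrix (Fin n) (Fin n) ℝ) (hJ : J.IsSymm)
    (μ : Measure (Matrix (Fin n) (Fin n) ℝ)) [IsProbabilityMeasure μ]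
    (hsupp : μ {Q | Qᵀ * Q = 1} = 1)
    (hinv : ∀ Q₀ : Matrix (Fin n) (Fin n) ℝ, Q₀ᵀ * Q₀ = 1 →
      Measure.map (fun Q => Q₀ * Q) μ = μ) :
    ∫ Q, isingP (Qᵀ * J * Q) ∂μ ≤ sphP J := by
  have hae : ∀ᵐ Q ∂μ, Qᵀ * Q = 1 := by
    rw [ae_iff]
    exact (prob_compl_eq_zero_iff measurableSet_orthogonal).2 hsupp
  have hf : Measurable fun y : Fin n → ℝ ↦ Real.exp ((1 / 2) * qf J y) :=
    ((measurable_qf J).const_mul _).exp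
  have hmeas (b : Fin n → Bool) :
      Measurable fun Q : Matrix (Fin n) (Fin n) ℝ ↦ Real.exp ((1 / 2) * qf J (Q *ᵥ sgn b)) :=
    hf.comp (measurable_mulVec_left _)
  have hZ : Measurable fun Q : Matrix (Fin n) (Fin n) ℝ ↦ isingZ (Qᵀ * J * Q) := by
    simp only [isingZ, qf_conj]
    exact (Finset.measurable_sum _ fun b _ ↦ hmeas b).const_mul _
  have hbound (b : Fin n → Bool) {Q : Matrix (Fin n) (Fin n) ℝ} (hQ : Qᵀ * Q = 1) :=
    exp_half_qf_mem_Icc J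
      ((dotProduct_mulVec_self_of_orthogonal hQ (sgn b)).trans (sgn_dotProduct_self b))
  have hmean (b : Fin n → Bool) :
      ∫ Q, Real.exp ((1 / 2) * qf J (Q *ᵥ sgn b)) ∂μ = sphZ J := by
    rw [sphZ, integral_eq_lintegral_of_nonneg_ae (.of_forall fun _ ↦ (Real.exp_pos _).le)
        (hmeas b).aestronglyMeasurable,
      integral_eq_lintegral_of_nonneg_ae (.of_forall fun _ ↦ (Real.exp_pos _).le)
        (hf.comp (WithLp.measurable_ofLp 2 _)).aestronglyMeasurable,
      lintegral_mulVec_eq_lintegral_unifSphere hn hae hinv hf.ennreal_ofReal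
        (sgn_dotProduct_self b)]
  have hZmean : ∫ Q, isingZ (Qᵀ * J * Q) ∂μ = sphZ J := by
    simp only [isingZ, qf_conj]
    rw [integral_const_mul, integral_finsetSum _ fun b _ ↦
      .of_mem_Icc _ _ (hmeas b).aemeasurable (hae.mono fun Q hQ ↦ hbound b hQ)]
    simp only [hmean]
    simp
  simp only [isingP, sphP]
  rw [integral_const_mul, ← hZmean]
  have hZbound := hae.mono fun Q hQ ↦ isingZ_mem_Icc (J := Qᵀ * J * Q) fun b ↦ by
    rw [qf_conj]
    exact hbound b hQ
  exact mul_le_mul_of_nonneg_left (integral_log_le_log_integral hZ (Real.exp_pos _) hZbound)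
    (by positivity)
end

section
/- For every sequence (J_n)_{n≥1} of symmetric matrices J_n ∈ ℝ^{n×n} with eigenvalues λ_1(J_n) ≥ ⋯ ≥ λ_n(J_n), and every sequence of reals (s_n) with s_n > λ_1(J_n)/2 for all n, one has limsup_{n→∞} [ p^S(J_n) − s_n + (1 + log 2)/2 + (1/(2n)) Σ_{i=1}^n log(s_n − λ_i(J_n)/2) ] ≤ 0. -/
open MeasureTheory Matrix Real Filter

/-- Polar-coordinate computation of the volume of the ellipsoid `‖T x‖ < 1`. -/
theorem lintegral_toSphere_inv_norm_pow {E : Type*} [NormedAddCommGroup E] [NormedSpace ℝ E]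
    [FiniteDimensional ℝ E] [Nontrivial E] [MeasurableSpace E] [BorelSpace E]
    (μ : Measure E) [μ.IsAddHaarMeasure] (T : E →ₗ[ℝ] E) (hT : LinearMap.det T ≠ 0) :
    ∫⁻ θ : Metric.sphere (0 : E) 1, ENNReal.ofReal (‖T θ‖⁻¹ ^ Module.finrank ℝ E) ∂μ.toSphere =
      ENNReal.ofReal |(LinearMap.det T)⁻¹| * μ.toSphere Set.univ := by
  have hTc : Continuous T := T.continuous_of_finiteDimensional
  have hinj : Function.Injective T :=
    (LinearMap.equivOfDetNeZero T hT).injective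
  have hpos : ∀ θ : Metric.sphere (0 : E) 1, 0 < ‖T θ‖ := fun θ => by
    rw [norm_pos_iff]
    intro h
    have : (θ : E) = 0 := hinj (by rw [h, map_zero])
    exact ne_zero_of_mem_unit_sphere θ this
  have hd : 0 < Module.finrank ℝ E := Module.finrank_pos
  set d := Module.finrank ℝ E with hd_def
  let S : Set (Metric.sphere (0 : E) 1 × Set.Ioi (0 : ℝ)) := {p | (p.2 : ℝ) * ‖T p.1‖ < 1}
  have hS : MeasurableSet S := by
    apply IsOpen.measurableSet
    apply isOpen_lt _ continuous_const
    fun_prop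
  have h1 : μ (T ⁻¹' Metric.ball 0 1) = (μ.toSphere.prod (Measure.volumeIoiPow (d - 1))) S := by
    rw [← μ.measurePreserving_homeomorphUnitSphereProd.measure_preimage hS.nullMeasurableSet]
    have h2 : (homeomorphUnitSphereProd E) ⁻¹' S =
        ((↑) : ({0}ᶜ : Set E) → E) ⁻¹' (T ⁻¹' Metric.ball 0 1) := by
      ext x
      have hx : ‖(x : E)‖ ≠ 0 := norm_ne_zero_iff.2 x.2
      simp [S, norm_smul, mul_inv_cancel_left₀ hx]
    rw [h2, comap_subtype_coe_apply (MeasurableSet.compl (measurableSet_singleton _)),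
      Subtype.image_preimage_coe, Set.inter_comm, ← Set.sdiff_eq,
      measure_sdiff_null (measure_singleton _)]
  have h3 : ∀ θ : Metric.sphere (0 : E) 1,
      Measure.volumeIoiPow (d - 1) (Prod.mk θ ⁻¹' S) =
        (d : ENNReal)⁻¹ * ENNReal.ofReal (‖T θ‖⁻¹ ^ d) := fun θ => by
    have : Prod.mk θ ⁻¹' S = Set.Iio (⟨‖T θ‖⁻¹, inv_pos.2 (hpos θ)⟩ : Set.Ioi (0 : ℝ)) := by
      ext r
      simp only [S, Set.mem_preimage, Set.mem_ofPred_eq, Set.mem_Iio, ← Subtype.coe_lt_coe]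
      rw [← one_div, lt_div_iff₀ (hpos θ)]
    rw [this, Measure.volumeIoiPow_apply_Iio, Nat.sub_add_cancel hd, Nat.cast_sub hd,
      Nat.cast_one, sub_add_cancel, div_eq_inv_mul, ENNReal.ofReal_mul (by positivity),
      ENNReal.ofReal_inv_of_pos (by exact_mod_cast hd), ENNReal.ofReal_natCast]
  rw [Measure.prod_apply hS, lintegral_congr h3, lintegral_const_mul' _ _ (by simp [hd.ne']),
    Measure.addHaar_preimage_linearMap μ hT] at h1
  rw [Measure.toSphere_apply_univ, mul_left_comm, h1, ← mul_assoc,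
    ENNReal.mul_inv_cancel (Nat.cast_ne_zero.2 hd.ne') (ENNReal.natCast_ne_top _), one_mul]

/-- A quadratic form `s ‖x‖² - ½ xᵀJx` whose coefficients `s - λᵢ/2` are positive is `‖T x‖²` for
some linear map `T`, with `(det T)² = ∏ᵢ (s - λᵢ/2)`. -/
theorem exists_linearMap_norm_sq_eq {n : ℕ} (J : Matrix (Fin n) (Fin n) ℝ) (hJ : J.IsHermitian)
    (s : ℝ) (hs : ∀ i, hJ.eigenvalues i / 2 < s) :
    ∃ T : EuclideanSpace ℝ (Fin n) →ₗ[ℝ] EuclideanSpace ℝ (Fin n),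
      (LinearMap.det T) ^ 2 = ∏ i, (s - hJ.eigenvalues i / 2) ∧
      ∀ x, ‖T x‖ ^ 2 = s * ‖x‖ ^ 2 - (1 / 2) * qf J x := by
  set a : Fin n → ℝ := fun i => s - hJ.eigenvalues i / 2 with ha_def
  have ha : ∀ i, 0 ≤ a i := fun i => (sub_pos.2 (hs i)).le
  set U : Matrix (Fin n) (Fin n) ℝ := hJ.eigenvectorUnitary.1 with hU
  have hUU : U * Uᵀ = 1 := by
    have := Unitary.coe_mul_star_self hJ.eigenvectorUnitary
    simpa [star_eq_conjTranspose, hU] using this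
  have hspec : J = U * diagonal hJ.eigenvalues * Uᵀ := by
    have := hJ.spectral_theorem
    rw [Unitary.conjStarAlgAut_apply] at this
    simpa [star_eq_conjTranspose, hU, Function.comp_def] using this
  set B : Matrix (Fin n) (Fin n) ℝ := diagonal (fun i => √(a i)) * Uᵀ with hB
  have hBB : Bᵀ * B = s • (1 : Matrix (Fin n) (Fin n) ℝ) - (1 / 2 : ℝ) • J := by
    have h1 : Bᵀ * B = U * diagonal a * Uᵀ := by
      have : diagonal (fun i => √(a i)) * diagonal (fun i => √(a i)) = diagonal a := by
        rw [diagonal_mul_diagonal]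
        congr 1
        ext i
        exact Real.mul_self_sqrt (ha i)
      rw [hB, transpose_mul, transpose_transpose, diagonal_transpose, ← this]
      simp only [Matrix.mul_assoc]
    have h2 : diagonal a = s • (1 : Matrix (Fin n) (Fin n) ℝ)
        - (1 / 2 : ℝ) • diagonal hJ.eigenvalues := by
      rw [← diagonal_one, ← diagonal_smul, ← diagonal_smul, diagonal_sub]
      congr 1
      ext i
      simp only [ha_def, Pi.smul_apply, smul_eq_mul]
      ring
    rw [h1, h2, Matrix.mul_sub, Matrix.sub_mul]
    conv_rhs => rw [hspec]
    simp [hUU]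
  refine ⟨toLpLin 2 2 B, ?_, fun x => ?_⟩
  · rw [LinearMap.det_toLpLin, hB, det_mul, det_diagonal, mul_pow, ← Finset.prod_pow]
    have : Uᵀ.det ^ 2 = 1 := by
      rw [sq]
      nth_rewrite 1 [det_transpose]
      rw [← det_mul, hUU, det_one]
    rw [this, mul_one]
    exact Finset.prod_congr rfl fun i _ => Real.sq_sqrt (ha i)
  · have h1 : ‖toLpLin 2 2 B x‖ ^ 2 = (B *ᵥ x.ofLp) ⬝ᵥ (B *ᵥ x.ofLp) := by
      rw [EuclideanSpace.real_norm_sq_eq]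
      simp [dotProduct, sq]
    have h2 : ‖x‖ ^ 2 = x.ofLp ⬝ᵥ x.ofLp := by
      rw [EuclideanSpace.real_norm_sq_eq]
      simp [dotProduct, sq]
    have h3 : qf J x = x.ofLp ⬝ᵥ (J *ᵥ x.ofLp) := by
      simp [qf, dotProduct, mulVec, Finset.mul_sum, mul_assoc]
    rw [h1, h2, h3, dotProduct_mulVec, ← mulVec_transpose, mulVec_mulVec, hBB, sub_mulVec,
      smul_mulVec, smul_mulVec, one_mulVec, sub_dotProduct, smul_dotProduct, smul_dotProduct,
      smul_eq_mul, smul_eq_mul, dotProduct_comm (J *ᵥ _)]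

theorem exp_neg_mul_sq_le (n : ℕ) {t : ℝ} (ht : 0 < t) :
    Real.exp (-(n * t ^ 2)) ≤ Real.exp (-(n * ((1 + Real.log 2) / 2))) * t⁻¹ ^ n := by
  have h1 : Real.log (2 * t ^ 2) ≤ 2 * t ^ 2 - 1 := Real.log_le_sub_one_of_pos (by positivity)
  rw [Real.log_mul (by norm_num) (by positivity), Real.log_pow] at h1
  push_cast at h1
  have h2 : t⁻¹ ^ n = Real.exp (-(n * Real.log t)) := by
    rw [← mul_neg, Real.exp_nat_mul, Real.exp_neg, Real.exp_log ht]
  rw [h2, ← Real.exp_add, Real.exp_le_exp]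
  have hn : (0 : ℝ) ≤ n := n.cast_nonneg
  nlinarith

theorem qf_smul {n : ℕ} (J : Matrix (Fin n) (Fin n) ℝ) (c : ℝ) (x : EuclideanSpace ℝ (Fin n)) :
    qf J (c • x : EuclideanSpace ℝ (Fin n)) = c ^ 2 * qf J x := by
  simp only [qf, Finset.mul_sum, PiLp.smul_apply, smul_eq_mul]
  refine Finset.sum_congr rfl fun i _ => Finset.sum_congr rfl fun j _ => ?_
  ring

theorem continuous_qf {n : ℕ} (J : Matrix (Fin n) (Fin n) ℝ) :
    Continuous fun x : EuclideanSpace ℝ (Fin n) => qf J x := by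
  unfold qf
  fun_prop

theorem sphZ_eq {n : ℕ} (J : Matrix (Fin n) (Fin n) ℝ) :
    sphZ J = ((volume : Measure (EuclideanSpace ℝ (Fin n))).toSphere Set.univ)⁻¹.toReal *
      ∫ θ : Metric.sphere (0 : EuclideanSpace ℝ (Fin n)) 1, Real.exp ((1 / 2) * (n * qf J θ.1))
        ∂(volume : Measure (EuclideanSpace ℝ (Fin n))).toSphere := by
  have hc : Continuous fun x : EuclideanSpace ℝ (Fin n) => Real.exp ((1 / 2) * qf J x) :=
    Real.continuous_exp.comp (continuous_const.mul (continuous_qf J))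
  unfold sphZ unifSphere
  rw [integral_map (by fun_prop) hc.aestronglyMeasurable, integral_smul_measure, smul_eq_mul]
  simp only [qf_smul, Real.sq_sqrt n.cast_nonneg]

theorem sphP_le {n : ℕ} (hn : 0 < n) (J : Matrix (Fin n) (Fin n) ℝ) (hJ : J.IsHermitian)
    (s : ℝ) (hs : ∀ i, hJ.eigenvalues i / 2 < s) :
    sphP J - s + (1 + Real.log 2) / 2 +
      (1 / (2 * (n : ℝ))) * ∑ i, Real.log (s - hJ.eigenvalues i / 2) ≤ 0 := by
  have : Nonempty (Fin n) := ⟨⟨0, hn⟩⟩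
  have hn' : (0 : ℝ) < n := by exact_mod_cast hn
  obtain ⟨T, hdet, hnorm⟩ := exists_linearMap_norm_sq_eq J hJ s hs
  have hprod : 0 < ∏ i, (s - hJ.eigenvalues i / 2) := Finset.prod_pos fun i _ => sub_pos.2 (hs i)
  have hT : LinearMap.det T ≠ 0 := by
    intro h
    rw [h] at hdet
    norm_num at hdet
    exact hprod.ne hdet
  have hinj : Function.Injective T := (LinearMap.equivOfDetNeZero T hT).injective
  set σ := (volume : Measure (EuclideanSpace ℝ (Fin n))).toSphere with hσ
  have hσ0 : σ Set.univ ≠ 0 := Measure.measure_univ_ne_zero.2 (Measure.toSphere_ne_zero _)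
  have hσt : σ Set.univ ≠ ⊤ := measure_ne_top _ _
  set f : Metric.sphere (0 : EuclideanSpace ℝ (Fin n)) 1 → ℝ :=
    fun θ => Real.exp ((1 / 2) * (n * qf J θ.1)) with hf
  have hfc : Continuous f := Real.continuous_exp.comp (continuous_const.mul
    (continuous_const.mul ((continuous_qf J).comp continuous_subtype_val)))
  have hfi : Integrable f σ :=
    hfc.integrable_of_hasCompactSupport (HasCompactSupport.of_compactSpace f)
  set C : ℝ := Real.exp (n * s - n * ((1 + Real.log 2) / 2)) with hC
  have hbound : ∀ θ, f θ ≤ C * ‖T θ‖⁻¹ ^ n := fun θ => by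
    have ht : 0 < ‖T θ‖ := by
      rw [norm_pos_iff]
      intro h
      exact ne_zero_of_mem_unit_sphere θ (hinj (by rw [h, map_zero]))
    have h1 := hnorm θ
    rw [norm_eq_of_mem_sphere θ] at h1
    have h2 : f θ = Real.exp (n * s) * Real.exp (-(n * ‖T θ‖ ^ 2)) := by
      rw [h1, ← Real.exp_add, hf]
      ring_nf
    rw [h2, hC, sub_eq_add_neg, Real.exp_add, mul_assoc]
    exact mul_le_mul_of_nonneg_left (exp_neg_mul_sq_le n ht) (Real.exp_pos _).le
  have hint : ∫ θ, f θ ∂σ ≤ C * |(LinearMap.det T)⁻¹| * (σ Set.univ).toReal := by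
    rw [integral_eq_lintegral_of_nonneg_ae (Eventually.of_forall fun θ => (Real.exp_pos _).le)
      hfi.aestronglyMeasurable]
    have key := lintegral_toSphere_inv_norm_pow volume T hT
    rw [finrank_euclideanSpace_fin, ← hσ] at key
    have hle : ∫⁻ θ, ENNReal.ofReal (f θ) ∂σ ≤
        ENNReal.ofReal C * (ENNReal.ofReal |(LinearMap.det T)⁻¹| * σ Set.univ) := by
      rw [← key, ← lintegral_const_mul' _ _ ENNReal.ofReal_ne_top]
      refine lintegral_mono fun θ => ?_
      rw [← ENNReal.ofReal_mul (Real.exp_pos _).le]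
      exact ENNReal.ofReal_le_ofReal (hbound θ)
    refine (ENNReal.toReal_mono (by finiteness) hle).trans_eq ?_
    rw [ENNReal.toReal_mul, ENNReal.toReal_mul, ENNReal.toReal_ofReal (Real.exp_pos _).le,
      ENNReal.toReal_ofReal (abs_nonneg _), mul_assoc]
  have hσpos : 0 < (σ Set.univ).toReal := ENNReal.toReal_pos hσ0 hσt
  have hZ : sphZ J ≤ C * |(LinearMap.det T)⁻¹| := by
    rw [sphZ_eq, ENNReal.toReal_inv, inv_mul_le_iff₀ hσpos, mul_comm]
    exact hint
  have hZpos : 0 < sphZ J := by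
    have : NeZero σ := ⟨Measure.toSphere_ne_zero _⟩
    rw [sphZ_eq, ENNReal.toReal_inv]
    exact mul_pos (inv_pos.2 hσpos) (integral_exp_pos hfi)
  have hlogdet : Real.log |(LinearMap.det T)⁻¹| =
      -(1 / 2 * ∑ i, Real.log (s - hJ.eigenvalues i / 2)) := by
    rw [← Real.log_prod fun i _ => (sub_pos.2 (hs i)).ne', ← hdet, Real.log_abs, Real.log_inv,
      Real.log_pow]
    push_cast
    ring
  have hlog := Real.log_le_log hZpos hZ
  rw [Real.log_mul (Real.exp_pos _).ne' (abs_pos.2 (inv_ne_zero hT)).ne', Real.log_exp,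
    hlogdet] at hlog
  have h := mul_le_mul_of_nonneg_left hlog (inv_pos.2 hn').le
  have heq : (n : ℝ)⁻¹ * (n * s - n * ((1 + Real.log 2) / 2)
      + -(1 / 2 * ∑ i, Real.log (s - hJ.eigenvalues i / 2))) = s - (1 + Real.log 2) / 2
      - (1 / (2 * (n : ℝ))) * ∑ i, Real.log (s - hJ.eigenvalues i / 2) := by
    field_simp
    ring
  rw [heq] at h
  unfold sphP
  linarith

/-- Unlike `Filter.limsup_le_of_le`, no boundedness is needed: for real sequences tending to `-∞`
the limsup takes the value `0`. -/
theorem limsup_nonpos_of_eventually_nonpos {u : ℕ → ℝ} (h : ∀ᶠ n in atTop, u n ≤ 0) :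
    limsup u atTop ≤ 0 := by
  rw [limsup_eq]
  by_cases hb : BddBelow {a | ∀ᶠ n in atTop, u n ≤ a}
  · exact csInf_le hb h
  · exact (Real.sInf_of_not_bddBelow hb).le

/-- For any sequence of symmetric matrices `Jₙ ∈ ℝ^{n×n}` and reals `sₙ > λ_max(Jₙ)/2`,
`limsup_n [ p^S(Jₙ) - sₙ + (1 + log 2)/2 + (1/(2n)) ∑ᵢ log(sₙ - λᵢ(Jₙ)/2) ] ≤ 0`. -/
theorem stmt_6 (J : ∀ n : ℕ, Matrix (Fin n) (Fin n) ℝ) (hJ : ∀ n, (J n).IsHermitian)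
    (s : ℕ → ℝ) (hs : ∀ n, ∀ i : Fin n, (hJ n).eigenvalues i / 2 < s n) :
    Filter.limsup (fun n : ℕ =>
        sphP (J n) - s n + (1 + Real.log 2) / 2 +
          (1 / (2 * (n : ℝ))) * ∑ i, Real.log (s n - (hJ n).eigenvalues i / 2))
      atTop ≤ 0 := by
  refine limsup_nonpos_of_eventually_nonpos ?_
  filter_upwards [eventually_gt_atTop 0] with n hn
  exact sphP_le hn (J n) (hJ n) (s n) (hs n)
end

section
/- The function η ↦ (1/2) log η + H( 1/2 + (1/2)√(1 − 1/η) ) is strictly increasing on [1, ∞), and its value at η = 1 is log 2. -/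
open Real

/-- The binary entropy function `H(x) = -x log x - (1-x) log (1-x)`
(with the convention `log 0 = 0`, so `H 0 = H 1 = 0`). -/
noncomputable def binH (x : ℝ) : ℝ := -x * Real.log x - (1 - x) * Real.log (1 - x)

theorem log_one_add_sub_log_one_sub_lt {s : ℝ} (h0 : 0 < s) (h1 : s < 1) :
    Real.log (1 + s) - Real.log (1 - s) < 2 * s / (1 - s ^ 2) := by
  have hp : 0 < 1 + s := by linarith
  have hm : 0 < 1 - s := by linarith
  have hy : 1 < (1 + s) / (1 - s) := by rw [one_lt_div hm]; linarith
  have h := Real.self_lt_sinh_iff.mpr (Real.log_pos hy)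
  rw [Real.sinh_log (by positivity), Real.log_div hp.ne' hm.ne'] at h
  refine h.trans_eq ?_
  have hs : 1 - s ^ 2 ≠ 0 := by nlinarith
  field_simp
  ring

theorem strictMonoOn_neg_mul_log_one_add_sub_mul_log_one_sub :
    StrictMonoOn
      (fun s : ℝ => -(1 + s / 2) * Real.log (1 + s) - (1 - s / 2) * Real.log (1 - s))
      (Set.Ico 0 1) := by
  have hd : ∀ s ∈ Set.Ico (0 : ℝ) 1, HasDerivAt
      (fun s : ℝ => -(1 + s / 2) * Real.log (1 + s) - (1 - s / 2) * Real.log (1 - s))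
      (s / (1 - s ^ 2) - (Real.log (1 + s) - Real.log (1 - s)) / 2) s := by
    rintro s ⟨h0, h1⟩
    have hp : 1 + s ≠ 0 := by linarith
    have hm : 1 - s ≠ 0 := by linarith
    have hid := hasDerivAt_id' s
    have hlp := (hid.const_add 1).log hp
    have hlm := (hid.const_sub 1).log hm
    refine ((((hid.div_const 2).const_add 1).fun_neg.fun_mul hlp).fun_sub
      (((hid.div_const 2).const_sub 1).fun_mul hlm)).congr_deriv ?_
    rw [show 1 - s ^ 2 = (1 + s) * (1 - s) by ring]
    field_simp
    ring
  refine strictMonoOn_of_deriv_pos (convex_Ico 0 1)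
    (fun s hs => (hd s hs).continuousAt.continuousWithinAt) fun s hs => ?_
  rw [interior_Ico] at hs
  rw [(hd s ⟨hs.1.le, hs.2⟩).deriv]
  have h := log_one_add_sub_log_one_sub_lt hs.1 hs.2
  rw [mul_div_assoc] at h
  linarith

theorem binH_half_add_half_mul {s : ℝ} (h0 : 0 ≤ s) (h1 : s < 1) :
    binH (1 / 2 + 1 / 2 * s) = Real.log 2 -
      (1 + s) / 2 * Real.log (1 + s) - (1 - s) / 2 * Real.log (1 - s) := by
  rw [binH, show 1 / 2 + 1 / 2 * s = (1 + s) / 2 by ring,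
    show 1 - (1 + s) / 2 = (1 - s) / 2 by ring,
    Real.log_div (by linarith) two_ne_zero, Real.log_div (by linarith) two_ne_zero]
  ring

theorem sqrt_one_sub_one_div_mem_Ico {η : ℝ} (h : 1 ≤ η) :
    Real.sqrt (1 - 1 / η) ∈ Set.Ico (0 : ℝ) 1 := by
  refine ⟨Real.sqrt_nonneg _, ?_⟩
  have : 0 < 1 / η := by positivity
  rw [Real.sqrt_lt' one_pos]
  linarith

theorem half_log_add_binH_eq {η : ℝ} (h : 1 ≤ η) :
    (1 / 2) * Real.log η + binH (1 / 2 + (1 / 2) * Real.sqrt (1 - 1 / η)) = Real.log 2 +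
      (-(1 + Real.sqrt (1 - 1 / η) / 2) * Real.log (1 + Real.sqrt (1 - 1 / η)) -
        (1 - Real.sqrt (1 - 1 / η) / 2) * Real.log (1 - Real.sqrt (1 - 1 / η))) := by
  obtain ⟨h0, h1⟩ := sqrt_one_sub_one_div_mem_Ico h
  have hη : 0 ≤ 1 - 1 / η := by
    rw [sub_nonneg, div_le_one (by linarith)]
    exact h
  have hsq := Real.sq_sqrt hη
  rw [binH_half_add_half_mul h0 h1]
  generalize Real.sqrt (1 - 1 / η) = s at *
  have hlog : Real.log η = -(Real.log (1 + s) + Real.log (1 - s)) := by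
    rw [← Real.log_mul (by linarith) (by linarith), ← Real.log_inv,
      show (1 + s) * (1 - s) = η⁻¹ by rw [← one_div]; linear_combination -hsq, inv_inv]
  rw [hlog]
  ring

/-- The function `η ↦ (1/2) log η + H(1/2 + (1/2)√(1 - 1/η))` is strictly increasing on
`[1, ∞)`, and its value at `η = 1` is `log 2`. -/
theorem stmt_18 :
    StrictMonoOn
        (fun η : ℝ => (1 / 2) * Real.log η + binH (1 / 2 + (1 / 2) * Real.sqrt (1 - 1 / η)))
        (Set.Ici (1 : ℝ)) ∧
      (1 / 2) * Real.log 1 + binH (1 / 2 + (1 / 2) * Real.sqrt (1 - 1 / 1)) = Real.log 2 := by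
  refine ⟨fun a ha b hb hab => ?_, ?_⟩
  · simp only [half_log_add_binH_eq ha, half_log_add_binH_eq hb]
    have hlt : Real.sqrt (1 - 1 / a) < Real.sqrt (1 - 1 / b) := by
      have ha0 : 0 < a := one_pos.trans_le ha
      have hb1 : 1 / b ≤ 1 := by
        rw [div_le_one (ha0.trans hab)]
        exact hb
      have ha1 : 1 / a ≤ 1 := by
        rw [div_le_one ha0]
        exact ha
      exact Real.sqrt_lt_sqrt (by linarith) (by linarith [one_div_lt_one_div_of_lt ha0 hab])
    have hmono := strictMonoOn_neg_mul_log_one_add_sub_mul_log_one_sub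
      (sqrt_one_sub_one_div_mem_Ico ha) (sqrt_one_sub_one_div_mem_Ico hb) hlt
    simp only at hmono
    linarith
  · rw [half_log_add_binH_eq le_rfl]
    simp
end

section
/- For every real η with 0 < η ≤ 1, one has sup_{x ∈ [0,1]} { H(x) + (η/2)(2x − 1)² } = log 2, and the supremum is attained at x = 1/2. -/
open Real

theorem binH_eq_binEntropy (x : ℝ) : binH x = binEntropy x := by
  rw [binH, binEntropy_eq_negMulLog_add_negMulLog_one_sub, negMulLog, negMulLog]
  ring

theorem concaveOn_binEntropy_add_sq :
    ConcaveOn ℝ (Set.Icc 0 1) fun x : ℝ => binEntropy x + 1 / 2 * (2 * x - 1) ^ 2 := by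
  refine concaveOn_of_hasDerivWithinAt2_nonpos (convex_Icc 0 1) (by fun_prop)
    (f' := fun x => log (1 - x) - log x + 2 * (2 * x - 1))
    (f'' := fun x => -1 / (1 - x) - 1 / x + 4) ?_ ?_ ?_ <;>
    rw [interior_Icc] <;> rintro x ⟨hx₀, hx₁⟩ <;> have hx₁' : 0 < 1 - x := sub_pos.2 hx₁
  · have hsq : HasDerivAt (fun x : ℝ => 1 / 2 * (2 * x - 1) ^ 2) (2 * (2 * x - 1)) x :=
      (((((hasDerivAt_id x).const_mul 2).sub_const 1).pow 2).const_mul (1 / 2)).congr_deriv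
        (by norm_num; ring)
    exact ((hasDerivAt_binEntropy hx₀.ne' hx₁.ne).add hsq).hasDerivWithinAt
  · have hlin : HasDerivAt (fun x : ℝ => 2 * (2 * x - 1)) 4 x :=
      ((((hasDerivAt_id x).const_mul 2).sub_const 1).const_mul 2).congr_deriv (by norm_num)
    have hlog := ((hasDerivAt_id x).const_sub 1).log hx₁'.ne'
    exact ((hlog.sub ((hasDerivAt_id x).log hx₀.ne')).add hlin).hasDerivWithinAt
  · have h : -1 / (1 - x) - 1 / x + 4 = -(2 * x - 1) ^ 2 / (x * (1 - x)) := by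
      field_simp
      ring
    rw [h]
    exact div_nonpos_of_nonpos_of_nonneg (neg_nonpos.2 (sq_nonneg _)) (by positivity)

theorem binEntropy_add_sq_le_log_two {x : ℝ} (hx : x ∈ Set.Icc (0 : ℝ) 1) :
    binEntropy x + 1 / 2 * (2 * x - 1) ^ 2 ≤ log 2 := by
  have hx' : 1 - x ∈ Set.Icc (0 : ℝ) 1 := ⟨by linarith [hx.2], by linarith [hx.1]⟩
  have h := concaveOn_binEntropy_add_sq.2 hx hx'
    (inv_nonneg.2 zero_le_two) (inv_nonneg.2 zero_le_two) (by norm_num)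
  have hmid : (2⁻¹ : ℝ) * x + 2⁻¹ * (1 - x) = 2⁻¹ := by ring
  simp only [smul_eq_mul, hmid, binEntropy_one_sub, binEntropy_two_inv] at h
  linarith

/-- For `0 < η ≤ 1`, `sup_{x ∈ [0,1]} { H(x) + (η/2)(2x-1)² } = log 2`, and the supremum is
attained at `x = 1/2`. -/
theorem stmt_19 (η : ℝ) (hη₀ : 0 < η) (hη₁ : η ≤ 1) :
    (⨆ x : Set.Icc (0 : ℝ) 1, (binH x + η / 2 * (2 * (x : ℝ) - 1) ^ 2)) = Real.log 2 ∧
      binH (1 / 2) + η / 2 * (2 * (1 / 2 : ℝ) - 1) ^ 2 = Real.log 2 := by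
  have hhalf : binH (1 / 2) + η / 2 * (2 * (1 / 2 : ℝ) - 1) ^ 2 = Real.log 2 := by
    rw [binH_eq_binEntropy, one_div, binEntropy_two_inv]
    ring
  have hle (x : Set.Icc (0 : ℝ) 1) :
      binH x + η / 2 * (2 * (x : ℝ) - 1) ^ 2 ≤ Real.log 2 := by
    rw [binH_eq_binEntropy]
    nlinarith [binEntropy_add_sq_le_log_two x.2, sq_nonneg (2 * (x : ℝ) - 1)]
  refine ⟨le_antisymm (ciSup_le hle) ?_, hhalf⟩
  exact hhalf.ge.trans (le_ciSup (f := fun x : Set.Icc (0 : ℝ) 1 =>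
    binH x + η / 2 * (2 * (x : ℝ) - 1) ^ 2) ⟨Real.log 2, Set.forall_mem_range.2 hle⟩
    ⟨1 / 2, by norm_num, by norm_num⟩)
end
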